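/- Let d ≥ 1 and n ≥ 2. If Q is a real polynomial of degree n−2 in d variables such that ∫_{B^d} Q(x) g(x) (1−‖x‖²) dx = 0 for every polynomial g of degree at most n−3, then P(x) = (1−‖x‖²)Q(x) satisfies L_{−1} P = −n(n+d−2) P. Consequently, since harmonic polynomials homogeneous of degree n also satisfy this equation, every element of H_n^d ⊕ (1−‖x‖²)V_{n−2}^d(W_1) is an eigenfunction of L_{−1} with eigenvalue −n(n+d−2). -/

import Mathlib

open MvPolynomial MeasureTheory

/-- The Laplacian `Δ = ∑ ∂²/∂xᵢ²` acting on polynomials in `d` variables. -/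
noncomputable def lap {d : ℕ} (P : MvPolynomial (Fin d) ℝ) : MvPolynomial (Fin d) ℝ :=
  ∑ i, pderiv i (pderiv i P)

/-- The Euler operator `⟨x,∇⟩ = ∑ xᵢ ∂/∂xᵢ` acting on polynomials in `d` variables. -/
noncomputable def eulerOp {d : ℕ} (P : MvPolynomial (Fin d) ℝ) : MvPolynomial (Fin d) ℝ :=
  ∑ i, X i * pderiv i P

/-- The operator `L_μ P = ΔP − ⟨x,∇⟩²P − (2μ+d)⟨x,∇⟩P`. -/
noncomputable def Lop (d : ℕ) (μ : ℝ) (P : MvPolynomial (Fin d) ℝ) : MvPolynomial (Fin d) ℝ :=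
  lap P - eulerOp (eulerOp P) - (2 * μ + (d : ℝ)) • eulerOp P

/-- The polynomial `‖x‖² = x₁² + ⋯ + x_d²`. -/
noncomputable def normSq (d : ℕ) : MvPolynomial (Fin d) ℝ := ∑ i, X i ^ 2

/-- Evaluation of a polynomial at a point of Euclidean space. -/
noncomputable def evalP {d : ℕ} (f : MvPolynomial (Fin d) ℝ)
    (x : EuclideanSpace ℝ (Fin d)) : ℝ :=
  MvPolynomial.eval (fun i => x i) f

/-- The closed unit ball `B^d ⊆ ℝ^d`. -/
noncomputable def ballD (d : ℕ) : Set (EuclideanSpace ℝ (Fin d)) :=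
  Metric.closedBall 0 1

lemma pderiv_normSq {d : ℕ} (i : Fin d) : pderiv i (normSq d) = 2 * X i := by
  classical
  rw [normSq, map_sum, Finset.sum_eq_single i]
  · rw [pderiv_pow]; simp
  · intro j _ hj
    rw [pderiv_pow, pderiv_X_of_ne hj]; simp
  · simp

lemma eulerOp_add {d : ℕ} (p q : MvPolynomial (Fin d) ℝ) :
    eulerOp (p + q) = eulerOp p + eulerOp q := by
  simp [eulerOp, mul_add, Finset.sum_add_distrib]

lemma eulerOp_smul {d : ℕ} (c : ℝ) (p : MvPolynomial (Fin d) ℝ) :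
    eulerOp (c • p) = c • eulerOp p := by
  simp [eulerOp, Finset.smul_sum]

lemma lap_add {d : ℕ} (p q : MvPolynomial (Fin d) ℝ) : lap (p + q) = lap p + lap q := by
  simp [lap, Finset.sum_add_distrib]

lemma eulerOp_mul {d : ℕ} (p q : MvPolynomial (Fin d) ℝ) :
    eulerOp (p * q) = eulerOp p * q + p * eulerOp q := by
  simp only [eulerOp, pderiv_mul, Finset.sum_mul, Finset.mul_sum, ← Finset.sum_add_distrib]
  exact Finset.sum_congr rfl fun i _ => by ring

lemma Lop_add {d : ℕ} (μ : ℝ) (p q : MvPolynomial (Fin d) ℝ) :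
    Lop d μ (p + q) = Lop d μ p + Lop d μ q := by
  simp only [Lop, lap_add, eulerOp_add, smul_add]
  abel

lemma eulerOp_one_sub_normSq (d : ℕ) : eulerOp (1 - normSq d) = -2 * normSq d := by
  simp only [eulerOp, map_sub, pderiv_one, pderiv_normSq]
  rw [normSq, Finset.mul_sum]
  exact Finset.sum_congr rfl fun i _ => by ring

lemma eulerOp_normSq (d : ℕ) : eulerOp (normSq d) = 2 * normSq d := by
  simp only [eulerOp, pderiv_normSq]
  rw [normSq, Finset.mul_sum]
  exact Finset.sum_congr rfl fun i _ => by ring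

lemma lap_one_sub_normSq_mul {d : ℕ} (q : MvPolynomial (Fin d) ℝ) :
    lap ((1 - normSq d) * q) =
      (1 - normSq d) * lap q - 4 * eulerOp q - 2 * (d : MvPolynomial (Fin d) ℝ) * q := by
  have key (i : Fin d) : pderiv i (pderiv i ((1 - normSq d) * q)) =
      (1 - normSq d) * pderiv i (pderiv i q) - 4 * (X i * pderiv i q) - 2 * q := by
    have h2 : pderiv i (2 : MvPolynomial (Fin d) ℝ) = 0 := by
      exact_mod_cast Derivation.map_natCast (pderiv i) 2
    simp only [pderiv_mul, map_add, map_sub, pderiv_one, pderiv_normSq, pderiv_X_self, map_neg,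
      zero_sub, h2]
    ring
  simp only [lap, key, Finset.sum_sub_distrib, ← Finset.mul_sum, eulerOp, Finset.sum_const,
    Finset.card_univ, Fintype.card_fin, nsmul_eq_mul]
  ring

/-- Multiplication by `1 - ‖x‖²` intertwines `L₋₁` and `L₁ - 2d`. -/
lemma Lop_neg_one_one_sub_normSq_mul {d : ℕ} (q : MvPolynomial (Fin d) ℝ) :
    Lop d (-1) ((1 - normSq d) * q) = (1 - normSq d) * (Lop d 1 q - (2 * d : ℝ) • q) := by
  have h2 : eulerOp (-2 * normSq d : MvPolynomial (Fin d) ℝ) = -4 * normSq d := by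
    have : (-2 * normSq d : MvPolynomial (Fin d) ℝ) = (-2 : ℝ) • normSq d := by
      simp only [smul_eq_C_mul, map_neg, map_ofNat]
    rw [this, eulerOp_smul, eulerOp_normSq, smul_eq_C_mul]
    simp only [map_neg, map_ofNat]
    ring
  simp only [Lop, lap_one_sub_normSq_mul, eulerOp_mul, eulerOp_add, eulerOp_one_sub_normSq, h2,
    smul_eq_C_mul]
  simp only [map_add, map_mul, map_neg, map_ofNat, map_natCast, map_one]
  ring

/-- `(1 - ‖x‖²)(g L₁ f - f L₁ g)` is the divergence of a vector field divisible by `1 - ‖x‖²`. -/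
lemma sum_pderiv_eq_Lop_one_antisymm {d : ℕ} (f g : MvPolynomial (Fin d) ℝ) :
    ∑ i, pderiv i ((1 - normSq d) * (g * (pderiv i f - X i * eulerOp f) -
        f * (pderiv i g - X i * eulerOp g))) =
      (1 - normSq d) * (g * Lop d 1 f - f * Lop d 1 g) := by
  have key (i : Fin d) : pderiv i ((1 - normSq d) * (g * (pderiv i f - X i * eulerOp f) -
        f * (pderiv i g - X i * eulerOp g))) =
      ((1 - normSq d) * eulerOp g - 2 * g) * (X i * pderiv i f)
      + (2 * f - (1 - normSq d) * eulerOp f) * (X i * pderiv i g)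
      + (2 * g * eulerOp f - 2 * f * eulerOp g) * X i ^ 2
      + ((1 - normSq d) * g) * pderiv i (pderiv i f)
      - ((1 - normSq d) * f) * pderiv i (pderiv i g)
      - ((1 - normSq d) * g) * (X i * pderiv i (eulerOp f))
      + ((1 - normSq d) * f) * (X i * pderiv i (eulerOp g))
      + (1 - normSq d) * (f * eulerOp g - g * eulerOp f) := by
    simp only [pderiv_mul, map_sub, pderiv_one, pderiv_normSq, pderiv_X_self]
    ring
  have hE (p : MvPolynomial (Fin d) ℝ) : ∑ i, X i * pderiv i p = eulerOp p := rfl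
  have hL (p : MvPolynomial (Fin d) ℝ) : ∑ i, pderiv i (pderiv i p) = lap p := rfl
  have hN : ∑ i : Fin d, (X i : MvPolynomial (Fin d) ℝ) ^ 2 = normSq d := rfl
  simp only [key, Finset.sum_sub_distrib, Finset.sum_add_distrib, ← Finset.mul_sum, hE, hL, hN,
    Finset.sum_const, Finset.card_univ, Fintype.card_fin, nsmul_eq_mul, Lop, smul_eq_C_mul]
  simp only [map_add, map_mul, map_ofNat, map_natCast, map_one]
  ring

lemma coeff_eulerOp {d : ℕ} (p : MvPolynomial (Fin d) ℝ) (s : Fin d →₀ ℕ) :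
    coeff s (eulerOp p) = s.degree * coeff s p := by
  induction p using MvPolynomial.induction_on' with
  | monomial t a =>
    have : eulerOp (monomial t a) = t.degree • monomial t a := by
      simp only [eulerOp, X_mul_pderiv_monomial, ← Finset.sum_smul, Finsupp.degree_eq_sum]
    rw [this, coeff_smul, coeff_monomial]
    split_ifs with h
    · simp [h]
    · simp
  | add p q hp hq => rw [eulerOp_add, coeff_add, hp, hq, coeff_add, mul_add]

lemma coeff_lap_eq_zero {d : ℕ} (p : MvPolynomial (Fin d) ℝ) (s : Fin d →₀ ℕ)
    (hs : p.totalDegree ≤ s.degree) : coeff s (lap p) = 0 := by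
  simp only [lap, coeff_sum, coeff_pderiv]
  refine Finset.sum_eq_zero fun i _ => ?_
  rw [coeff_eq_zero_of_totalDegree_lt]
  · simp
  · change _ < Finsupp.degree _
    simp
    omega

lemma coeff_Lop_of_totalDegree_le {d : ℕ} (μ : ℝ) (p : MvPolynomial (Fin d) ℝ) (s : Fin d →₀ ℕ)
    (hs : p.totalDegree ≤ s.degree) :
    coeff s (Lop d μ p) = -(s.degree * (s.degree + 2 * μ + d)) * coeff s p := by
  simp only [Lop, coeff_sub, coeff_smul, coeff_eulerOp, coeff_lap_eq_zero p s hs, smul_eq_mul]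
  ring

lemma totalDegree_lt_of_coeff_eq_zero {d k : ℕ} {p : MvPolynomial (Fin d) ℝ} (hk : 0 < k)
    (h : ∀ s : Fin d →₀ ℕ, k ≤ s.degree → coeff s p = 0) : p.totalDegree < k := by
  refine (Finset.sup_lt_iff hk).mpr fun s hs => ?_
  change s.degree < k
  by_contra! hc
  exact mem_support_iff.mp hs (h s hc)

lemma totalDegree_Lop_le {d : ℕ} (μ : ℝ) (p : MvPolynomial (Fin d) ℝ) :
    (Lop d μ p).totalDegree ≤ p.totalDegree := by
  refine Nat.lt_succ_iff.mp (totalDegree_lt_of_coeff_eq_zero (Nat.succ_pos _) fun s hs => ?_)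
  rw [coeff_Lop_of_totalDegree_le μ p s (by omega), coeff_eq_zero_of_totalDegree_lt, mul_zero]
  change _ < s.degree
  omega

lemma evalP_add {d : ℕ} (p q : MvPolynomial (Fin d) ℝ) : evalP (p + q) = evalP p + evalP q := by
  ext x
  simp [evalP]

lemma evalP_mul {d : ℕ} (p q : MvPolynomial (Fin d) ℝ) : evalP (p * q) = evalP p * evalP q := by
  ext x
  simp [evalP]

lemma evalP_one_sub_normSq {d : ℕ} (x : EuclideanSpace ℝ (Fin d)) :
    evalP (1 - normSq d) x = 1 - ‖x‖ ^ 2 := by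
  simp [evalP, normSq, EuclideanSpace.norm_sq_eq]

lemma contDiff_evalP {d : ℕ} (p : MvPolynomial (Fin d) ℝ) : ContDiff ℝ 1 (evalP p) := by
  induction p using MvPolynomial.induction_on with
  | C a =>
    have : evalP (C a : MvPolynomial (Fin d) ℝ) = fun _ => a := by ext x; simp [evalP]
    rw [this]
    exact contDiff_const
  | add p q hp hq => rw [evalP_add]; exact hp.add hq
  | mul_X p j hp =>
    have hX : evalP (X j : MvPolynomial (Fin d) ℝ) = fun x => x j := by ext x; simp [evalP]
    rw [evalP_mul, hX]
    exact hp.mul (by fun_prop)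

lemma hasLineDerivAt_evalP {d : ℕ} (p : MvPolynomial (Fin d) ℝ) (x : EuclideanSpace ℝ (Fin d))
    (i : Fin d) :
    HasLineDerivAt ℝ (evalP p) (evalP (pderiv i p) x) x (EuclideanSpace.single i 1) := by
  classical
  induction p using MvPolynomial.induction_on with
  | C a => simpa [evalP, HasLineDerivAt] using hasDerivAt_const _ _
  | add p q hp hq =>
    rw [evalP_add, map_add, evalP_add]
    exact HasDerivAt.add hp hq
  | mul_X p j hp =>
    have hX : HasLineDerivAt ℝ (evalP (X j)) (evalP (pderiv i (X j)) x) x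
        (EuclideanSpace.single i 1) := by
      by_cases h : j = i
      · subst h
        simpa [evalP, HasLineDerivAt] using (hasDerivAt_id' (0 : ℝ)).const_add (x j)
      · simpa [evalP, HasLineDerivAt, h, pderiv_X_of_ne h] using
          hasDerivAt_const (0 : ℝ) (x j)
    rw [evalP_mul]
    have h := HasDerivAt.mul hp hX
    simp only [zero_smul, add_zero] at h
    simp only [pderiv_mul, evalP_add, evalP_mul, Pi.add_apply, Pi.mul_apply]
    exact h

lemma integrableOn_evalP {d : ℕ} (p : MvPolynomial (Fin d) ℝ) :
    IntegrableOn (evalP p) (ballD d) :=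
  (contDiff_evalP p).continuous.continuousOn.integrableOn_compact (isCompact_closedBall _ _)

lemma setIntegral_evalP_add {d : ℕ} (p q : MvPolynomial (Fin d) ℝ) :
    ∫ x in ballD d, evalP (p + q) x = (∫ x in ballD d, evalP p x) + ∫ x in ballD d, evalP q x := by
  rw [evalP_add]
  exact integral_add (integrableOn_evalP p) (integrableOn_evalP q)

lemma setIntegral_evalP_smul {d : ℕ} (c : ℝ) (p : MvPolynomial (Fin d) ℝ) :
    ∫ x in ballD d, evalP (c • p) x = c * ∫ x in ballD d, evalP p x := by
  rw [← integral_const_mul]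
  simp [evalP, smul_eval]

lemma setIntegral_evalP_sum {d : ℕ} {ι : Type*} (s : Finset ι) (p : ι → MvPolynomial (Fin d) ℝ) :
    ∫ x in ballD d, evalP (∑ i ∈ s, p i) x = ∑ i ∈ s, ∫ x in ballD d, evalP (p i) x := by
  rw [← integral_finsetSum _ fun i _ => integrableOn_evalP (p i)]
  simp [evalP]

/-- The divergence theorem on the ball for vector fields vanishing on the boundary. -/
lemma setIntegral_pderiv_one_sub_normSq_mul {d : ℕ} (h : MvPolynomial (Fin d) ℝ) (i : Fin d) :
    ∫ x in ballD d, evalP (pderiv i ((1 - normSq d) * h)) x = 0 := by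
  let χ : ContDiffBump (0 : EuclideanSpace ℝ (Fin d)) := ⟨2, 3, by norm_num, by norm_num⟩
  let v : EuclideanSpace ℝ (Fin d) := EuclideanSpace.single i 1
  let F : EuclideanSpace ℝ (Fin d) → ℝ := fun x => χ x * evalP h x
  let G : EuclideanSpace ℝ (Fin d) → ℝ := fun x => max (χ x * evalP (1 - normSq d) x) 0
  obtain ⟨C₁, hF⟩ : ∃ C, LipschitzWith C F :=
    ContDiff.lipschitzWith_of_hasCompactSupport (χ.hasCompactSupport.mul_right)
      (χ.contDiff.mul (contDiff_evalP h)) one_ne_zero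
  obtain ⟨C₂, hG₀⟩ : ∃ C, LipschitzWith C fun x => χ x * evalP (1 - normSq d) x :=
    ContDiff.lipschitzWith_of_hasCompactSupport (χ.hasCompactSupport.mul_right)
      (χ.contDiff.mul (contDiff_evalP _)) one_ne_zero
  have hG : LipschitzWith C₂ G := hG₀.max_const 0
  have hG_out (x : EuclideanSpace ℝ (Fin d)) (hx : 1 < ‖x‖) : G x = 0 := by
    refine max_eq_right (mul_nonpos_of_nonneg_of_nonpos χ.nonneg ?_)
    rw [evalP_one_sub_normSq]
    nlinarith
  have hχ (x : EuclideanSpace ℝ (Fin d)) (hx : ‖x‖ < 1) : χ x = 1 :=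
    χ.one_of_mem_closedBall (by simpa [χ] using by linarith)
  have hF_in (x : EuclideanSpace ℝ (Fin d)) (hx : ‖x‖ < 1) : F x = evalP h x := by
    simp [F, hχ x hx]
  have hG_in (x : EuclideanSpace ℝ (Fin d)) (hx : ‖x‖ < 1) : G x = evalP (1 - normSq d) x := by
    simp only [G, hχ x hx, one_mul, evalP_one_sub_normSq]
    exact max_eq_left (by nlinarith [norm_nonneg x])
  have hG_supp : HasCompactSupport G := by
    refine HasCompactSupport.of_support_subset_isCompact
      (isCompact_closedBall (0 : EuclideanSpace ℝ (Fin d)) 1) fun x hx => ?_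
    by_contra hx'
    exact hx (hG_out x (by simpa using hx'))
  have nhds_in (x : EuclideanSpace ℝ (Fin d)) (hx : ‖x‖ < 1) : ∀ᶠ y in nhds x, ‖y‖ < 1 :=
    continuous_norm.continuousAt.eventually_lt_const hx
  have nhds_out (x : EuclideanSpace ℝ (Fin d)) (hx : 1 < ‖x‖) : ∀ᶠ y in nhds x, 1 < ‖y‖ :=
    continuous_norm.continuousAt.eventually_const_lt hx
  have hF' (x : EuclideanSpace ℝ (Fin d)) (hx : ‖x‖ < 1) :
      lineDeriv ℝ F x v = evalP (pderiv i h) x :=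
    ((hasLineDerivAt_evalP h x i).congr_of_eventuallyEq
      ((nhds_in x hx).mono hF_in)).lineDeriv
  have hG' (x : EuclideanSpace ℝ (Fin d)) (hx : ‖x‖ < 1) :
      lineDeriv ℝ G x v = evalP (pderiv i (1 - normSq d)) x :=
    ((hasLineDerivAt_evalP _ x i).congr_of_eventuallyEq
      ((nhds_in x hx).mono hG_in)).lineDeriv
  have hG'_out (x : EuclideanSpace ℝ (Fin d)) (hx : 1 < ‖x‖) : lineDeriv ℝ G x v = 0 := by
    have : HasLineDerivAt ℝ (fun _ : EuclideanSpace ℝ (Fin d) => (0 : ℝ)) 0 x v :=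
      hasDerivAt_const _ _
    exact (this.congr_of_eventuallyEq ((nhds_out x hx).mono hG_out)).lineDeriv
  have hsphere : ∀ᵐ x : EuclideanSpace ℝ (Fin d), ‖x‖ ≠ 1 := by
    have := Measure.addHaar_sphere_of_ne_zero (volume : Measure (EuclideanSpace ℝ (Fin d)))
      0 one_ne_zero
    rw [ae_iff]
    convert this using 2
    ext x
    simp
  have hmeas : MeasurableSet (ballD d) := Metric.isClosed_closedBall.measurableSet
  have hleft : ∫ x, lineDeriv ℝ F x v * G x =
      ∫ x in ballD d, evalP (pderiv i h * (1 - normSq d)) x := by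
    rw [← integral_indicator hmeas]
    refine integral_congr_ae (hsphere.mono fun x hx => ?_)
    rcases lt_or_gt_of_ne hx with hx | hx
    · simp [ballD, hx.le, hF' x hx, hG_in x hx, evalP_mul]
    · simp [ballD, hx.not_ge, hG_out x hx]
  have hright : ∫ x, lineDeriv ℝ G x (-v) * F x =
      -∫ x in ballD d, evalP (pderiv i (1 - normSq d) * h) x := by
    rw [← integral_indicator hmeas, ← integral_neg]
    refine integral_congr_ae (hsphere.mono fun x hx => ?_)
    rcases lt_or_gt_of_ne hx with hx | hx
    · simp only [lineDeriv_neg, hG' x hx, hF_in x hx, evalP_mul]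
      simp [ballD, hx.le]
    · simp [ballD, hx.not_ge, lineDeriv_neg, hG'_out x hx]
  have := hF.integral_lineDeriv_mul_eq (μ := volume) hG hG_supp v
  rw [hleft, hright] at this
  rw [pderiv_mul, setIntegral_evalP_add, mul_comm (1 - normSq d), this, add_neg_cancel]

/-- `L₁` is symmetric with respect to the weight `1 - ‖x‖²` on the ball. -/
lemma setIntegral_Lop_one_symm {d : ℕ} (f g : MvPolynomial (Fin d) ℝ) :
    ∫ x in ballD d, evalP ((1 - normSq d) * (Lop d 1 f * g)) x =
      ∫ x in ballD d, evalP ((1 - normSq d) * (f * Lop d 1 g)) x := by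
  have h : (1 - normSq d) * (Lop d 1 f * g) =
      (1 - normSq d) * (f * Lop d 1 g) + (1 - normSq d) * (g * Lop d 1 f - f * Lop d 1 g) := by
    ring
  rw [h, setIntegral_evalP_add, ← sum_pderiv_eq_Lop_one_antisymm, setIntegral_evalP_sum]
  simp only [setIntegral_pderiv_one_sub_normSq_mul, Finset.sum_const_zero, add_zero]

lemma eq_zero_of_setIntegral_mul_self {d : ℕ} (p : MvPolynomial (Fin d) ℝ)
    (h : ∫ x in ballD d, evalP ((1 - normSq d) * (p * p)) x = 0) : p = 0 := by
  have hmeas : MeasurableSet (ballD d) := Metric.isClosed_closedBall.measurableSet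
  have hnonneg : 0 ≤ᵐ[volume.restrict (ballD d)] evalP ((1 - normSq d) * (p * p)) := by
    refine (ae_restrict_iff' hmeas).mpr (.of_forall fun x hx => ?_)
    have hx' : ‖x‖ ≤ 1 := by simpa [ballD] using hx
    rw [evalP_mul, evalP_mul, Pi.mul_apply, Pi.mul_apply, evalP_one_sub_normSq]
    exact mul_nonneg (by nlinarith [norm_nonneg x]) (mul_self_nonneg _)
  have hae := (integral_eq_zero_iff_of_nonneg_ae hnonneg (integrableOn_evalP _)).mp h
  have heq : Set.EqOn (evalP ((1 - normSq d) * (p * p))) 0 (Metric.ball 0 1) :=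
    Measure.eqOn_open_of_ae_eq
      (ae_restrict_of_ae_restrict_of_subset Metric.ball_subset_closedBall hae) Metric.isOpen_ball
      (contDiff_evalP _).continuous.continuousOn continuousOn_const
  have hzero (x : EuclideanSpace ℝ (Fin d)) (hx : ‖x‖ < 1) : evalP p x = 0 := by
    have := heq (by simpa using hx : x ∈ Metric.ball 0 1)
    rw [evalP_mul, evalP_mul, Pi.mul_apply, Pi.mul_apply, evalP_one_sub_normSq] at this
    have hpos : 1 - ‖x‖ ^ 2 ≠ 0 := by nlinarith [norm_nonneg x]
    simpa [hpos] using this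
  have hmem : (WithLp.toLp 2 : (Fin d → ℝ) → EuclideanSpace ℝ (Fin d)) ⁻¹' Metric.ball 0 1 ∈
      nhds 0 :=
    (PiLp.continuous_toLp 2 _).continuousAt.preimage_mem_nhds (Metric.ball_mem_nhds _ one_pos)
  obtain ⟨ε, hε, hsub⟩ := Metric.mem_nhds_iff.mp hmem
  refine funext_set (fun _ => Metric.ball (0 : ℝ) ε) (fun _ => ?_) fun y hy => ?_
  · rw [Real.ball_eq_Ioo]
    exact Set.Ioo_infinite (by linarith)
  · have hy' : y ∈ Metric.ball (0 : Fin d → ℝ) ε := by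
      rw [ball_pi _ hε]
      exact hy
    rw [map_zero]
    simpa [evalP] using hzero (WithLp.toLp 2 y) (by simpa using hsub hy')

/-- Polynomials of degree `m` orthogonal to all polynomials of lower degree with respect to the
weight `1 - ‖x‖²` are eigenfunctions of `L₁`. -/
lemma Lop_one_eq_of_orthogonal {d m : ℕ} {q : MvPolynomial (Fin d) ℝ} (hdeg : q.totalDegree = m)
    (horth : ∀ g : MvPolynomial (Fin d) ℝ, g.totalDegree < m →
      ∫ x in ballD d, evalP ((1 - normSq d) * (q * g)) x = 0) :
    Lop d 1 q = (-(m * (m + 2 + d) : ℝ)) • q := by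
  set r := Lop d 1 q + (m * (m + 2 + d) : ℝ) • q with hr
  suffices r = 0 by rw [neg_smul, eq_neg_iff_add_eq_zero, ← hr, this]
  have hcoeff (s : Fin d →₀ ℕ) (hs : m ≤ s.degree) : coeff s r = 0 := by
    rw [hr, coeff_add, coeff_smul, coeff_Lop_of_totalDegree_le _ _ _ (hdeg.trans_le hs), smul_eq_mul]
    rcases hs.eq_or_lt with hs | hs
    · rw [← hs]; ring
    · have : coeff s q = 0 := coeff_eq_zero_of_totalDegree_lt (hdeg.trans_lt hs)
      simp [this]
  rcases m.eq_zero_or_pos with hm | hm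
  · ext s
    simpa using hcoeff s (by omega)
  · have hlt := totalDegree_lt_of_coeff_eq_zero hm hcoeff
    refine eq_zero_of_setIntegral_mul_self r ?_
    have h : (1 - normSq d) * (r * r) =
        (1 - normSq d) * (Lop d 1 q * r) +
          (m * (m + 2 + d) : ℝ) • ((1 - normSq d) * (q * r)) := by
      nth_rewrite 1 [hr]
      simp only [smul_eq_C_mul]
      ring
    rw [h, setIntegral_evalP_add, setIntegral_evalP_smul, setIntegral_Lop_one_symm,
      horth _ hlt, horth _ ((totalDegree_Lop_le 1 r).trans_lt hlt)]
    simp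

/-- Harmonic homogeneous polynomials are eigenfunctions of every `L_μ`. -/
lemma Lop_eq_of_isHomogeneous {d n : ℕ} (μ : ℝ) {p : MvPolynomial (Fin d) ℝ}
    (hp : p.IsHomogeneous n) (hlap : lap p = 0) :
    Lop d μ p = (-(n * (n + 2 * μ + d) : ℝ)) • p := by
  have hE : eulerOp p = (n : ℝ) • p := by
    rw [eulerOp, hp.sum_X_mul_pderiv, Nat.cast_smul_eq_nsmul]
  simp only [Lop, hlap, hE, eulerOp_smul, smul_smul]
  module

/-- if `Q` has degree `n−2` and `∫_{B^d} Q g (1−‖x‖²) dx = 0` for all `g`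
of degree at most `n−3` (i.e. `Q ∈ V_{n−2}^d(W_1)`), then `P = (1−‖x‖²)Q` satisfies
`L_{−1}P = −n(n+d−2)P`; consequently every element `Y + (1−‖x‖²)Q` of
`H_n^d ⊕ (1−‖x‖²)V_{n−2}^d(W_1)` (with `Y` harmonic homogeneous of degree `n`) is an
eigenfunction of `L_{−1}` with eigenvalue `−n(n+d−2)`. -/
theorem stmt3 (d n : ℕ) (hd : 1 ≤ d) (hn : 2 ≤ n)
    (Q : MvPolynomial (Fin d) ℝ) (hdeg : Q.totalDegree = n - 2)
    (horth : ∀ g : MvPolynomial (Fin d) ℝ, g.totalDegree + 2 < n →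
      ∫ x in ballD d, evalP Q x * evalP g x * (1 - ‖x‖ ^ 2) = 0) :
    Lop d (-1) ((1 - normSq d) * Q) =
        (-(n : ℝ) * ((n : ℝ) + (d : ℝ) - 2)) • ((1 - normSq d) * Q) ∧
      ∀ Y : MvPolynomial (Fin d) ℝ, Y.IsHomogeneous n → lap Y = 0 →
        Lop d (-1) (Y + (1 - normSq d) * Q) =
          (-(n : ℝ) * ((n : ℝ) + (d : ℝ) - 2)) • (Y + (1 - normSq d) * Q) := by
  obtain ⟨m, rfl⟩ : ∃ m, n = m + 2 := ⟨n - 2, by omega⟩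
  have hQ := Lop_one_eq_of_orthogonal (m := m) (by simpa using hdeg) fun g hg => by
    rw [← horth g (by omega)]
    refine integral_congr_ae (.of_forall fun x => ?_)
    simp only [evalP_mul, Pi.mul_apply, evalP_one_sub_normSq]
    ring
  have hP : Lop d (-1) ((1 - normSq d) * Q) =
      (-((m + 2 : ℕ) : ℝ) * (((m + 2 : ℕ) : ℝ) + (d : ℝ) - 2)) • ((1 - normSq d) * Q) := by
    rw [Lop_neg_one_one_sub_normSq_mul, hQ, ← sub_smul, mul_smul_comm]
    congr 1
    push_cast
    ring
  refine ⟨hP, fun Y hY hlap => ?_⟩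
  rw [Lop_add, hP, Lop_eq_of_isHomogeneous (-1) hY hlap, smul_add]
  congr 2
  ring
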